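/- arXiv:2502.17013 — 2 statements merged into one kernel-verified Lean document; each statement's English description precedes it below -/
import Mathlib

section
/- Let N be an n×n complex Hermitian positive definite matrix and h ∈ ℂⁿ. Then 0 < re(1 − hᴴ (N + h hᴴ)⁻¹ h) ≤ 1 and −log(re(1 − hᴴ (N + h hᴴ)⁻¹ h)) = log(1 + re(hᴴ N⁻¹ h)). (This is Lemma 1 of the paper in natural-logarithm form: with the optimal MMSE receiver and optimal weight V_opt = (1 − hᴴ(N + hhᴴ)⁻¹h)⁻¹, the WMMSE objective equals the achievable rate log(1 + hᴴ N⁻¹ h).) -/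
open Matrix

open scoped ComplexOrder

theorem Matrix.posDef_of_re_dotProduct_mulVec_pos {ι : Type*} [Fintype ι] {M : Matrix ι ι ℂ}
    (hM : M.IsHermitian) (hpos : ∀ x : ι → ℂ, x ≠ 0 → 0 < (star x ⬝ᵥ M *ᵥ x).re) :
    M.PosDef :=
  .of_dotProduct_mulVec_pos hM fun x hx =>
    Complex.pos_iff.2 ⟨hpos x hx, (hM.im_star_dotProduct_mulVec_self x).symm⟩

/-- The Sherman–Morrison formula for the complementary quadratic form of a rank-one update. -/
theorem Matrix.one_sub_dotProduct_inv_add_vecMulVec_mulVec {ι K : Type*} [Fintype ι]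
    [DecidableEq ι] [Field K] {M : Matrix ι ι K} {u v : ι → K} (hM : IsUnit M)
    (hMuv : IsUnit (M + vecMulVec u v)) (hne : 1 + v ⬝ᵥ M⁻¹ *ᵥ u ≠ 0) :
    1 - v ⬝ᵥ (M + vecMulVec u v)⁻¹ *ᵥ u = (1 + v ⬝ᵥ M⁻¹ *ᵥ u)⁻¹ := by
  rw [isUnit_iff_isUnit_det] at hM hMuv
  have hupdate : (M + vecMulVec u v) *ᵥ (M⁻¹ *ᵥ u) = (1 + v ⬝ᵥ M⁻¹ *ᵥ u) • u := by
    rw [add_mulVec, mulVec_mulVec, mul_nonsing_inv _ hM, one_mulVec, vecMulVec_mulVec,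
      op_smul_eq_smul, add_smul, one_smul]
  have hsolve : (M + vecMulVec u v)⁻¹ *ᵥ u = (1 + v ⬝ᵥ M⁻¹ *ᵥ u)⁻¹ • (M⁻¹ *ᵥ u) := by
    rw [eq_inv_smul_iff₀ hne, ← mulVec_smul, ← hupdate, mulVec_mulVec,
      nonsing_inv_mul _ hMuv, one_mulVec]
  rw [hsolve, dotProduct_smul, smul_eq_mul]
  field_simp
  ring

/-- Lemma 1 (natural-log form): the minimal MSE `1 − hᴴ(N + hhᴴ)⁻¹h` lies in `(0, 1]` and
`−log(re(1 − hᴴ(N + hhᴴ)⁻¹h)) = log(1 + re(hᴴ N⁻¹ h))`. -/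
theorem wmmse_rate_identity {n : ℕ} (N : Matrix (Fin n) (Fin n) ℂ)
    (hN : N.IsHermitian) (hPD : ∀ x : Fin n → ℂ, x ≠ 0 → 0 < (star x ⬝ᵥ N *ᵥ x).re)
    (h : Fin n → ℂ) :
    0 < (1 - star h ⬝ᵥ (N + vecMulVec h (star h))⁻¹ *ᵥ h).re ∧
    (1 - star h ⬝ᵥ (N + vecMulVec h (star h))⁻¹ *ᵥ h).re ≤ 1 ∧
    -Real.log ((1 - star h ⬝ᵥ (N + vecMulVec h (star h))⁻¹ *ᵥ h).re) =
      Real.log (1 + (star h ⬝ᵥ N⁻¹ *ᵥ h).re) := by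
  have hN' : N.PosDef := posDef_of_re_dotProduct_mulVec_pos hN hPD
  have hq : 0 ≤ star h ⬝ᵥ N⁻¹ *ᵥ h := hN'.inv.posSemidef.dotProduct_mulVec_nonneg h
  obtain ⟨r, hr, hrq⟩ : ∃ r : ℝ, 0 ≤ r ∧ star h ⬝ᵥ N⁻¹ *ᵥ h = r :=
    ⟨_, (Complex.nonneg_iff.1 hq).1, Complex.ext rfl (Complex.nonneg_iff.1 hq).2.symm⟩
  have hmse : 1 - star h ⬝ᵥ (N + vecMulVec h (star h))⁻¹ *ᵥ h = ((1 + r)⁻¹ : ℝ) := by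
    rw [one_sub_dotProduct_inv_add_vecMulVec_mulVec hN'.isUnit
      (hN'.add_posSemidef (posSemidef_vecMulVec_self_star h)).isUnit, hrq]
    · push_cast
      rfl
    · rw [hrq]
      exact_mod_cast (by positivity : 1 + r ≠ 0)
  rw [hmse, hrq, Complex.ofReal_re, Complex.ofReal_re, Real.log_inv, neg_neg]
  exact ⟨by positivity, inv_le_one_of_one_le₀ (by linarith), rfl⟩
end

section
/- Let N be an n×n complex Hermitian positive definite matrix, h ∈ ℂⁿ, v ∈ ℂⁿ, and V > 0 a real number. Then log(V) − V · re(1 + vᴴ (N + h hᴴ) v − vᴴ h − hᴴ v) + 1 ≤ log(1 + re(hᴴ N⁻¹ h)). (This is the WMMSE lower bound on the achievable rate used in the convergence proof of Algorithm 2: for any receiver v and any positive weight V, the surrogate objective never exceeds the true rate, with equality at v = v_opt and V = V_opt.) -/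
open Matrix

open scoped ComplexOrder

/-- The minimum over all receivers of the mean square error is at least `1 / (1 + SINR)`. -/
theorem inv_one_add_sinr_le_mse {n : Type*} [Fintype n] [DecidableEq n] {N : Matrix n n ℂ}
    (hN : N.PosDef) (h v : n → ℂ) :
    (1 + (star h ⬝ᵥ N⁻¹ *ᵥ h).re)⁻¹ ≤
      (1 + star v ⬝ᵥ (N + vecMulVec h (star h)) *ᵥ v - star v ⬝ᵥ h - star h ⬝ᵥ v).re := by
  have hs : 0 ≤ (star h ⬝ᵥ N⁻¹ *ᵥ h).re :=
    (Complex.le_def.mp (hN.inv.posSemidef.dotProduct_mulVec_nonneg h)).1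
  have hNg : N *ᵥ (N⁻¹ *ᵥ h) = h := by
    rw [mulVec_mulVec, mul_nonsing_inv _ ((isUnit_iff_isUnit_det N).mp hN.isUnit), one_mulVec]
  have hgN : ∀ x, star (N⁻¹ *ᵥ h) ⬝ᵥ N *ᵥ x = star h ⬝ᵥ x := fun x => by
    rw [dotProduct_mulVec, ← hN.isHermitian.eq, ← star_mulVec, hN.isHermitian.eq, hNg]
  have hgh : star (N⁻¹ *ᵥ h) ⬝ᵥ h = star h ⬝ᵥ N⁻¹ *ᵥ h := by
    rw [← hgN, hNg]
  have hvh : star v ⬝ᵥ h = star (star h ⬝ᵥ v) := star_dotProduct v h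
  set s := (star h ⬝ᵥ N⁻¹ *ᵥ h).re with hs_def
  set a : ℝ := (1 + s)⁻¹ with ha
  have has : a * (1 + s) = 1 := inv_mul_cancel₀ (by positivity)
  have key := (Complex.le_def.mp (hN.posSemidef.dotProduct_mulVec_nonneg
    (v - (a : ℂ) • N⁻¹ *ᵥ h))).1
  simp only [mulVec_sub, mulVec_smul, hNg, star_sub, star_smul, sub_dotProduct, dotProduct_sub,
    smul_dotProduct, dotProduct_smul, hgN, hgh, hvh, smul_eq_mul, Complex.star_def,
    Complex.conj_ofReal, Complex.sub_re, Complex.re_ofReal_mul, Complex.conj_re, Complex.zero_re,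
    ← hs_def] at key
  simp only [add_mulVec, dotProduct_add, vecMulVec_mulVec, dotProduct_smul, hvh, Complex.star_def,
    Complex.add_re, Complex.sub_re, Complex.one_re, Complex.conj_re, MulOpposite.smul_eq_mul_unop,
    MulOpposite.unop_op, Complex.mul_re, Complex.conj_im]
  generalize star h ⬝ᵥ v = t at *
  nlinarith [sq_nonneg (t.re - (1 - a)), sq_nonneg t.im, congrArg (a * ·) has]

/-- WMMSE surrogate lower bound: for Hermitian positive definite `N`, channel `h`, any
receiver `v`, and any weight `V > 0`,
`log V − V·re(MSE(v)) + 1 ≤ log(1 + re(hᴴ N⁻¹ h))`. -/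
theorem wmmse_surrogate_le_rate {n : ℕ} (N : Matrix (Fin n) (Fin n) ℂ)
    (hN : N.IsHermitian) (hPD : ∀ x : Fin n → ℂ, x ≠ 0 → 0 < (star x ⬝ᵥ N *ᵥ x).re)
    (h v : Fin n → ℂ) (V : ℝ) (hV : 0 < V) :
    Real.log V -
      V * (1 + star v ⬝ᵥ (N + vecMulVec h (star h)) *ᵥ v - star v ⬝ᵥ h - star h ⬝ᵥ v).re + 1 ≤
    Real.log (1 + (star h ⬝ᵥ N⁻¹ *ᵥ h).re) := by
  have hPos : N.PosDef := .of_dotProduct_mulVec_pos hN fun x hx =>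
    Complex.lt_def.mpr ⟨hPD x hx, (hN.im_star_dotProduct_mulVec_self x).symm⟩
  have hs : 0 < 1 + (star h ⬝ᵥ N⁻¹ *ᵥ h).re :=
    add_pos_of_pos_of_nonneg one_pos
      (Complex.le_def.mp (hPos.inv.posSemidef.dotProduct_mulVec_nonneg h)).1
  have hmse := mul_le_mul_of_nonneg_left (inv_one_add_sinr_le_mse hPos h v) hV.le
  have hlog := Real.log_le_sub_one_of_pos (mul_pos hV (inv_pos.mpr hs))
  rw [Real.log_mul hV.ne' (inv_pos.mpr hs).ne', Real.log_inv] at hlog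
  linarith
end
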